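/- arXiv:2405.01208 — 10 statements merged into one kernel-verified Lean document; each statement's English description precedes it below -/
import Mathlib

section
/- Let n and k be positive integers with 2 ≤ k ≤ n, and let X be an n×n real symmetric matrix such that every k×k principal submatrix of X is positive semidefinite and has rank 1. Then X spans an extreme ray of the k-PSD closure S⁺(n,k); that is, X ≠ 0, X ∈ S⁺(n,k), and whenever X = A + B with A, B ∈ S⁺(n,k), both A and B are nonnegative scalar multiples of X. -/
open Matrix

/-- The principal submatrix of `X` with rows and columns indexed by the subset `I`. -/
def principalSub {n : ℕ} (X : Matrix (Fin n) (Fin n) ℝ) (I : Finset (Fin n)) :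
    Matrix I I ℝ :=
  X.submatrix (fun i => (i : Fin n)) (fun j => (j : Fin n))

/-- Membership in the `k`-PSD closure `S⁺(n,k)`: `X` is an `n × n` real symmetric matrix
all of whose `k × k` principal submatrices are positive semidefinite. -/
def memPSDClosure {n : ℕ} (k : ℕ) (X : Matrix (Fin n) (Fin n) ℝ) : Prop :=
  X.IsSymm ∧ ∀ I : Finset (Fin n), I.card = k → (principalSub X I).PosSemidef

/-- `X` spans an extreme ray of the `k`-PSD closure `S⁺(n,k)`:
`X` is nonzero, `X ∈ S⁺(n,k)`, and whenever `X = A + B` with `A, B ∈ S⁺(n,k)`,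
both `A` and `B` are nonnegative scalar multiples of `X`. -/
def SpansExtremeRay {n : ℕ} (k : ℕ) (X : Matrix (Fin n) (Fin n) ℝ) : Prop :=
  X ≠ 0 ∧ memPSDClosure k X ∧
    ∀ A B : Matrix (Fin n) (Fin n) ℝ, memPSDClosure k A → memPSDClosure k B →
      X = A + B →
        (∃ a : ℝ, 0 ≤ a ∧ A = a • X) ∧ (∃ b : ℝ, 0 ≤ b ∧ B = b • X)

/-- The matrix `G(n,k) = (k/(k-1)) • I - (1/(k-1)) • J`, where `I` is the identity
and `J` is the all-ones matrix. -/
noncomputable def Gmat (n k : ℕ) : Matrix (Fin n) (Fin n) ℝ :=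
  ((k : ℝ) / ((k : ℝ) - 1)) • (1 : Matrix (Fin n) (Fin n) ℝ) -
    (1 / ((k : ℝ) - 1)) • Matrix.of (fun _ _ => (1 : ℝ))

theorem Matrix.mul_apply_swap_of_rank_eq_one {ι : Type*} [Fintype ι] [DecidableEq ι]
    {Y : Matrix ι ι ℝ} (hY : Y.rank = 1) (i j p q : ι) :
    Y i j * Y p q = Y i q * Y p j := by
  obtain ⟨v, hv⟩ := finrank_le_one_iff.mp (le_of_eq hY)
  have key : ∀ j, ∃ c : ℝ, ∀ i, Y i j = c * (v : ι → ℝ) i := by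
    intro j
    obtain ⟨c, hc⟩ := hv ⟨Y.mulVecLin (Pi.single j 1), LinearMap.mem_range_self _ _⟩
    refine ⟨c, fun i => ?_⟩
    have := congrFun (congrArg Subtype.val hc) i
    simpa using this.symm
  obtain ⟨c, hc⟩ := key j
  obtain ⟨d, hd⟩ := key q
  rw [hc, hd, hd, hc]
  ring

theorem Matrix.exists_diag_ne_zero_of_rank_eq_one {ι : Type*} [Fintype ι] [DecidableEq ι]
    {Y : Matrix ι ι ℝ} (hsymm : Y.IsSymm) (hY : Y.rank = 1) : ∃ m, Y m m ≠ 0 := by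
  by_contra! hdiag
  have hzero : Y = 0 := by
    ext i j
    have h := Matrix.mul_apply_swap_of_rank_eq_one hY i j j i
    rw [hsymm.apply i j, hdiag, zero_mul] at h
    simpa using h
  simp [hzero] at hY

/-- A positive semidefinite summand of a rank one positive semidefinite matrix is
proportional to it. -/
theorem Matrix.PosSemidef.eq_smul_of_rank_add_eq_one {ι : Type*} [Fintype ι] [DecidableEq ι]
    {P Q : Matrix ι ι ℝ} (hP : P.PosSemidef) (hQ : Q.PosSemidef) (hr : (P + Q).rank = 1)
    {m : ι} (hm : (P + Q) m m ≠ 0) (i j : ι) :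
    P i j = P m m / (P + Q) m m * (P + Q) i j := by
  set Y := P + Q with hY
  have hsymm : ∀ i j, P i j = P j i := fun i j => by simpa using (hP.isHermitian.apply i j).symm
  have hYsymm : ∀ i j, Y i j = Y j i := fun i j => by
    simpa [hY] using ((hP.add hQ).isHermitian.apply i j).symm
  have hcol : ∀ i j, P i j * Y m m = P i m * Y m j := by
    intro i j
    let x : ι → ℝ := Y m m • Pi.single j 1 - Y m j • Pi.single m 1
    have hYx : Y *ᵥ x = 0 := by
      ext p
      have := Matrix.mul_apply_swap_of_rank_eq_one hr p j m m
      simp [x, Matrix.mulVec_sub, Matrix.mulVec_smul]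
      linarith
    have hsum : star x ⬝ᵥ P *ᵥ x + star x ⬝ᵥ Q *ᵥ x = 0 := by
      rw [← dotProduct_add, ← Matrix.add_mulVec, ← hY, hYx, dotProduct_zero]
    have hPx : P *ᵥ x = 0 := by
      rw [← hP.dotProduct_mulVec_zero_iff]
      linarith [hP.dotProduct_mulVec_nonneg x, hQ.dotProduct_mulVec_nonneg x]
    have := congrFun hPx i
    simp [x, Matrix.mulVec_sub, Matrix.mulVec_smul] at this
    linarith
  have h₁ := hcol i j
  have h₂ := hcol m i
  have h₃ := Matrix.mul_apply_swap_of_rank_eq_one hr i j m m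
  rw [hsymm m i, hYsymm m i] at h₂
  rw [div_mul_eq_mul_div, eq_div_iff hm, h₁]
  apply mul_right_cancel₀ hm
  linear_combination Y m j * h₂ - P m m * h₃

theorem Finset.exists_pair_subset_card_eq {n k : ℕ} (hk2 : 2 ≤ k) (hkn : k ≤ n) (i j : Fin n) :
    ∃ I : Finset (Fin n), i ∈ I ∧ j ∈ I ∧ I.card = k := by
  obtain ⟨I, hI, hc⟩ := Finset.exists_superset_card_eq (s := {i, j}) (n := k)
    (Finset.card_le_two.trans hk2) (by simpa using hkn)
  exact ⟨I, hI (by simp), hI (by simp), hc⟩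

theorem memPSDClosure.exists_eq_smul_add {n k : ℕ} (hk2 : 2 ≤ k) (hkn : k ≤ n)
    {A B : Matrix (Fin n) (Fin n) ℝ} (hA : memPSDClosure k A) (hB : memPSDClosure k B)
    (hr : ∀ I : Finset (Fin n), I.card = k → (principalSub (A + B) I).rank = 1) :
    ∃ a : ℝ, 0 ≤ a ∧ A = a • (A + B) := by
  have hdiag : ∀ I : Finset (Fin n), I.card = k → ∃ m ∈ I, (A + B) m m ≠ 0 := by
    intro I hI
    obtain ⟨m, hm⟩ := Matrix.exists_diag_ne_zero_of_rank_eq_one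
      ((hA.1.add hB.1).submatrix _) (hr I hI)
    exact ⟨m, m.2, hm⟩
  have hloc : ∀ I : Finset (Fin n), I.card = k → ∀ m ∈ I, (A + B) m m ≠ 0 → ∀ i ∈ I, ∀ j ∈ I,
      A i j = A m m / (A + B) m m * (A + B) i j := fun I hI m hmI hm i hi j hj =>
    (hA.2 I hI).eq_smul_of_rank_add_eq_one (hB.2 I hI) (hr I hI)
      (m := ⟨m, hmI⟩) hm ⟨i, hi⟩ ⟨j, hj⟩
  have hn : 0 < n := by omega
  obtain ⟨I₀, -, -, hI₀⟩ := Finset.exists_pair_subset_card_eq hk2 hkn ⟨0, hn⟩ ⟨0, hn⟩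
  obtain ⟨p, hpI, hp⟩ := hdiag I₀ hI₀
  refine ⟨A p p / (A + B) p p, ?_, ?_⟩
  · have h₁ : 0 ≤ A p p := (hA.2 I₀ hI₀).diag_nonneg (i := ⟨p, hpI⟩)
    have h₂ : 0 ≤ B p p := (hB.2 I₀ hI₀).diag_nonneg (i := ⟨p, hpI⟩)
    exact div_nonneg h₁ (add_nonneg h₁ h₂)
  · ext i j
    obtain ⟨I, hi, hj, hI⟩ := Finset.exists_pair_subset_card_eq hk2 hkn i j
    obtain ⟨m, hmI, hm⟩ := hdiag I hI
    obtain ⟨J, hmJ, hpJ, hJ⟩ := Finset.exists_pair_subset_card_eq hk2 hkn m p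
    rw [hloc I hI m hmI hm i hi j hj, hloc J hJ p hpJ hp m hmJ m hmJ, mul_div_cancel_right₀ _ hm]
    rfl

/-- If `2 ≤ k ≤ n` and every `k × k` principal submatrix of the symmetric
matrix `X` is positive semidefinite of rank 1, then `X` spans an extreme ray of `S⁺(n,k)`. -/
theorem stmt0 {n k : ℕ} (hk2 : 2 ≤ k) (hkn : k ≤ n)
    (X : Matrix (Fin n) (Fin n) ℝ) (hX : X.IsSymm)
    (h : ∀ I : Finset (Fin n), I.card = k →
      (principalSub X I).PosSemidef ∧ (principalSub X I).rank = 1) :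
    SpansExtremeRay k X := by
  obtain ⟨I, -, hI⟩ := Finset.exists_superset_card_eq (s := (∅ : Finset (Fin n))) (n := k)
    (by simp) (by simpa using hkn)
  refine ⟨?_, ⟨hX, fun I hI => (h I hI).1⟩, ?_⟩
  · rintro rfl
    have hr := (h I hI).2
    simp [principalSub] at hr
  · rintro A B hA hB rfl
    refine ⟨hA.exists_eq_smul_add hk2 hkn hB fun I hI => (h I hI).2, ?_⟩
    rw [add_comm A B] at h ⊢
    exact hB.exists_eq_smul_add hk2 hkn hA fun I hI => (h I hI).2
end

section
/- For integers n ≥ 3 and 2 ≤ k ≤ n−1, the n×n matrix G(n,k) = (k/(k−1))·I − (1/(k−1))·J, where I is the n×n identity matrix and J is the n×n all-ones matrix, spans an extreme ray of the k-PSD closure S⁺(n,k). -/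
open Matrix

theorem Gmat_apply_self {n k : ℕ} (hk : 2 ≤ k) (i : Fin n) : Gmat n k i i = 1 := by
  have h : (2 : ℝ) ≤ k := by exact_mod_cast hk
  have h' : (k : ℝ) - 1 ≠ 0 := by linarith
  simp only [Gmat, Matrix.sub_apply, Matrix.smul_apply, one_apply_eq, of_apply, smul_eq_mul, mul_one]
  field_simp

theorem Gmat_apply_of_ne {n k : ℕ} {i j : Fin n} (hij : i ≠ j) :
    Gmat n k i j = -(1 / ((k : ℝ) - 1)) := by
  simp [Gmat, hij]

theorem Gmat_isSymm (n k : ℕ) : (Gmat n k).IsSymm := by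
  ext i j
  by_cases h : i = j
  · simp [h]
  · rw [transpose_apply, Gmat_apply_of_ne h, Gmat_apply_of_ne (Ne.symm h)]

theorem sum_Gmat_eq_zero {n k : ℕ} {I : Finset (Fin n)} (hI : I.card = k)
    {i : Fin n} (hi : i ∈ I) : ∑ j ∈ I, Gmat n k i j = 0 := by
  simp [Gmat, one_apply, Finset.sum_sub_distrib, hi, hI]
  ring

theorem Gmat_memPSDClosure {n k : ℕ} (hk : 2 ≤ k) : memPSDClosure k (Gmat n k) := by
  refine ⟨Gmat_isSymm n k, fun I hI => .of_dotProduct_mulVec_nonneg ?_ fun x => ?_⟩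
  · ext i j
    simpa [principalSub] using (Gmat_isSymm n k).apply (i : Fin n) (j : Fin n)
  · have h : (2 : ℝ) ≤ k := by exact_mod_cast hk
    have key : star x ⬝ᵥ (principalSub (Gmat n k) I *ᵥ x) =
        1 / ((k : ℝ) - 1) * (k * ∑ i, x i ^ 2 - (∑ i, x i) ^ 2) := by
      have hrow : ∀ i, (principalSub (Gmat n k) I *ᵥ x) i =
          1 / ((k : ℝ) - 1) * (k * x i - ∑ j, x j) := fun i => by
        have hij : ∀ j : I, principalSub (Gmat n k) I i j * x j =
            (if i = j then (k : ℝ) / (k - 1) * x j else 0) - 1 / ((k : ℝ) - 1) * x j := by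
          intro j
          by_cases hj : i = j
          · simp [principalSub, Gmat, hj, sub_mul]
          · simp [principalSub, Gmat, one_apply, hj]
        simp only [mulVec, dotProduct, hij, Finset.sum_sub_distrib, Finset.sum_ite_eq,
          Finset.mem_univ, if_true, ← Finset.mul_sum]
        ring
      simp only [dotProduct, hrow, star_trivial]
      calc _ = ∑ i, (1 / ((k : ℝ) - 1) * k * x i ^ 2 - 1 / ((k : ℝ) - 1) * (∑ j, x j) * x i) :=
            Finset.sum_congr rfl fun i _ => by ring
        _ = _ := by rw [Finset.sum_sub_distrib, ← Finset.mul_sum, ← Finset.mul_sum]; ring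
    rw [key]
    have hcs := sq_sum_le_card_mul_sum_sq (s := Finset.univ) (f := x)
    rw [Finset.card_univ, Fintype.card_coe, hI] at hcs
    exact mul_nonneg (one_div_nonneg.2 (by linarith)) (sub_nonneg.2 hcs)

theorem principalSub_mulVec_one {n : ℕ} (A : Matrix (Fin n) (Fin n) ℝ) (I : Finset (Fin n))
    (i : I) : (principalSub A I *ᵥ 1) i = ∑ j ∈ I, A i j := by
  simp only [mulVec, dotProduct, Pi.one_apply, mul_one]
  exact Finset.sum_coe_sort I (A i)

/-- If the blocks of a sum of two positive semidefinite blocks kill the all-ones vector,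
then so do the blocks of each summand. -/
theorem sum_eq_zero_of_sum_add_eq_zero {n k : ℕ} {A B : Matrix (Fin n) (Fin n) ℝ}
    (hA : memPSDClosure k A) (hB : memPSDClosure k B) {I : Finset (Fin n)} (hI : I.card = k)
    (hAB : ∀ i ∈ I, ∑ j ∈ I, (A + B) i j = 0) {i : Fin n} (hi : i ∈ I) :
    ∑ j ∈ I, A i j = 0 := by
  have hA' := hA.2 I hI
  have h1 := hA'.dotProduct_mulVec_nonneg 1
  have h2 := (hB.2 I hI).dotProduct_mulVec_nonneg 1
  have h3 : star (1 : I → ℝ) ⬝ᵥ (principalSub A I *ᵥ 1) +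
      star (1 : I → ℝ) ⬝ᵥ (principalSub B I *ᵥ 1) = 0 := by
    simp only [dotProduct, star_trivial, principalSub_mulVec_one, ← Finset.sum_add_distrib,
      ← mul_add]
    exact Finset.sum_eq_zero fun j _ => by
      simpa using hAB j j.2
  have h4 := (hA'.dotProduct_mulVec_zero_iff 1).1 (by linarith)
  rw [← principalSub_mulVec_one A I ⟨i, hi⟩, h4, Pi.zero_apply]

theorem exists_eq_smul_Gmat {n k : ℕ} (hk : 2 ≤ k) (hkn : k < n)
    {A : Matrix (Fin n) (Fin n) ℝ} (hA : memPSDClosure k A)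
    (hsum : ∀ I : Finset (Fin n), I.card = k → ∀ i ∈ I, ∑ j ∈ I, A i j = 0) :
    ∃ a : ℝ, 0 ≤ a ∧ A = a • Gmat n k := by
  have hk' : (2 : ℝ) ≤ k := by exact_mod_cast hk
  have hrow : ∀ i j l : Fin n, i ≠ j → i ≠ l → A i j = A i l := by
    intro i j l hij hil
    rcases eq_or_ne j l with rfl | hjl
    · rfl
    have hcard : k - 2 ≤ ({i, j, l}ᶜ : Finset (Fin n)).card := by
      rw [Finset.card_compl, Fintype.card_fin, Finset.card_eq_three.2 ⟨i, j, l, hij, hil, hjl, rfl⟩]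
      omega
    obtain ⟨S, hS, hSc⟩ := Finset.exists_subset_card_eq hcard
    have hiS : i ∉ S := fun h => by simpa using hS h
    have hjS : j ∉ S := fun h => by simpa using hS h
    have hlS : l ∉ S := fun h => by simpa using hS h
    have key : ∀ m, i ≠ m → m ∉ S → A i i + (A i m + ∑ j ∈ S, A i j) = 0 := by
      intro m him hmS
      have := hsum (insert i (insert m S)) (by
        rw [Finset.card_insert_of_notMem (by simp [him, hiS]), Finset.card_insert_of_notMem hmS]
        omega) i (by simp)
      rwa [Finset.sum_insert (by simp [him, hiS]), Finset.sum_insert hmS] at this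
    linarith [key j hij hjS, key l hil hlS]
  have hoff : ∀ i j p q : Fin n, i ≠ j → p ≠ q → A i j = A p q := by
    intro i j p q hij hpq
    rcases eq_or_ne i p with rfl | hip
    · exact hrow i j q hij hpq
    · rw [hrow i j p hij hip, ← hA.1.apply i p, hrow p i q hip.symm hpq]
  let x : Fin n := ⟨0, by omega⟩
  let y : Fin n := ⟨1, by omega⟩
  have hxy : x ≠ y := by simp [x, y]
  have hsup : ∀ i : Fin n, ∃ I : Finset (Fin n), i ∈ I ∧ I.card = k := by
    intro i
    obtain ⟨I, hI, -, hIc⟩ := Finset.exists_subsuperset_card_eq (Finset.subset_univ {i})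
      (n := k) (by simp; omega) (by simp; omega)
    exact ⟨I, by simpa using hI, hIc⟩
  have hdiag : ∀ i, A i i = -((k : ℝ) - 1) * A x y := by
    intro i
    obtain ⟨I, hi, hIc⟩ := hsup i
    have h := hsum I hIc i hi
    rw [← Finset.add_sum_erase I _ hi, Finset.sum_congr rfl fun j hj =>
      hoff i j x y (Finset.ne_of_mem_erase hj).symm hxy, Finset.sum_const,
      Finset.card_erase_of_mem hi, hIc, nsmul_eq_mul, Nat.cast_sub (by omega)] at h
    push_cast at h
    linarith
  refine ⟨A x x, ?_, ?_⟩
  · obtain ⟨I, hx, hIc⟩ := hsup x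
    exact (hA.2 I hIc).diag_nonneg (i := ⟨x, hx⟩)
  · ext i j
    rw [Matrix.smul_apply, smul_eq_mul]
    rcases eq_or_ne i j with rfl | hij
    · rw [Gmat_apply_self hk, hdiag i, hdiag x, mul_one]
    · have h' : (k : ℝ) - 1 ≠ 0 := by linarith
      rw [Gmat_apply_of_ne hij, hdiag x, hoff i j x y hij hxy]
      field_simp

/-- For `n ≥ 3` and `2 ≤ k ≤ n-1`, the matrix `G(n,k)` spans an extreme ray
of the `k`-PSD closure `S⁺(n,k)`. -/
theorem stmt3 {n k : ℕ} (hn : 3 ≤ n) (hk2 : 2 ≤ k) (hkn : k ≤ n - 1) :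
    SpansExtremeRay k (Gmat n k) := by
  refine ⟨fun h => ?_, Gmat_memPSDClosure hk2, fun A B hA hB hAB => ?_⟩
  · simpa [h] using Gmat_apply_self hk2 (⟨0, by omega⟩ : Fin n)
  · exact ⟨exists_eq_smul_Gmat hk2 (by omega) hA fun I hI i hi =>
        sum_eq_zero_of_sum_add_eq_zero hA hB hI
          (fun i hi => hAB ▸ sum_Gmat_eq_zero hI hi) hi,
      exists_eq_smul_Gmat hk2 (by omega) hB fun I hI i hi =>
        sum_eq_zero_of_sum_add_eq_zero hB hA hI
          (fun i hi => add_comm A B ▸ hAB ▸ sum_Gmat_eq_zero hI hi) hi⟩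
end

section
/- Let n ≥ 3 and let M ∈ S⁺(n,n−1) with rank(M) > 1. If there exists i ∈ {1,…,n} such that the (n−1)×(n−1) principal submatrix of M obtained by deleting row i and column i has rank strictly less than n−2, then M does not span an extreme ray of S⁺(n,n−1). -/
open Matrix

theorem principalSub_compl_singleton_mulVec {n : ℕ} (M : Matrix (Fin n) (Fin n) ℝ) {k : Fin n}
    {x : Fin n → ℝ} (hx : x k = 0) (l : ({k}ᶜ : Finset (Fin n))) :
    (principalSub M {k}ᶜ *ᵥ fun j => x j) l = (M *ᵥ x) l := by
  simp only [mulVec, dotProduct, principalSub, submatrix_apply]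
  rw [Finset.sum_coe_sort ({k}ᶜ : Finset (Fin n)) (fun j => M l j * x j),
    ← Finset.sum_compl_add_sum {k}]
  simp [hx]

theorem dotProduct_principalSub_compl_singleton_mulVec {n : ℕ} (M : Matrix (Fin n) (Fin n) ℝ)
    {k : Fin n} {x : Fin n → ℝ} (hx : x k = 0) :
    (fun j : ({k}ᶜ : Finset (Fin n)) => x j) ⬝ᵥ (principalSub M {k}ᶜ *ᵥ fun j => x j) =
      x ⬝ᵥ (M *ᵥ x) := by
  simp only [dotProduct, principalSub_compl_singleton_mulVec M hx]
  rw [Finset.sum_coe_sort ({k}ᶜ : Finset (Fin n)) (fun j => x j * (M *ᵥ x) j),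
    ← Finset.sum_compl_add_sum {k}]
  simp [hx]

theorem memPSDClosure.posSemidef_compl_singleton {n : ℕ} {M : Matrix (Fin n) (Fin n) ℝ}
    (hM : memPSDClosure (n - 1) M) (k : Fin n) : (principalSub M {k}ᶜ).PosSemidef :=
  hM.2 _ (by simp [Finset.card_compl])

theorem memPSDClosure_of_posSemidef {n : ℕ} (k : ℕ) {M : Matrix (Fin n) (Fin n) ℝ}
    (hM : M.PosSemidef) : memPSDClosure k M :=
  ⟨by simpa [IsHermitian, IsSymm, conjTranspose_eq_transpose_of_trivial] using hM.isHermitian,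
    fun _ _ => hM.submatrix _⟩

/-- A matrix in `S⁺(n,n-1)` with a nontrivial kernel is positive semidefinite. -/
theorem memPSDClosure.posSemidef_of_mulVec_eq_zero {n : ℕ} {M : Matrix (Fin n) (Fin n) ℝ}
    (hM : memPSDClosure (n - 1) M) {w : Fin n → ℝ} (hw : w ≠ 0) (hMw : M *ᵥ w = 0) :
    M.PosSemidef := by
  obtain ⟨k, hk⟩ := Function.ne_iff.mp hw
  have hsymm : Mᵀ = M := hM.1
  refine PosSemidef.of_dotProduct_mulVec_nonneg
    (by simpa [IsHermitian, conjTranspose_eq_transpose_of_trivial] using hsymm) fun x => ?_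
  have hwM : w ᵥ* M = 0 := by rw [← hsymm, vecMul_transpose, hMw]
  have hy : (x - (x k / w k) • w) k = 0 := by
    have : w k ≠ 0 := hk
    simp [this]
  have h := (hM.posSemidef_compl_singleton k).dotProduct_mulVec_nonneg
    (fun j => (x - (x k / w k) • w) j)
  rw [star_trivial, dotProduct_principalSub_compl_singleton_mulVec M hy] at h
  simpa [mulVec_sub, mulVec_smul, hMw, dotProduct_mulVec, sub_vecMul, smul_vecMul, hwM] using h

theorem memPSDClosure.exists_mulVec_eq_zero {n : ℕ} (hn : 3 ≤ n) {M : Matrix (Fin n) (Fin n) ℝ}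
    (hM : memPSDClosure (n - 1) M) {i : Fin n}
    (hi : (principalSub M ({i}ᶜ : Finset (Fin n))).rank < n - 2) :
    ∃ w : Fin n → ℝ, w ≠ 0 ∧ M *ᵥ w = 0 := by
  have : Nontrivial (Fin n) := Fin.nontrivial_iff_two_le.mpr (by omega)
  obtain ⟨j, hj⟩ := exists_ne i
  set A := principalSub M ({i}ᶜ : Finset (Fin n)) with hA
  let ev : LinearMap.ker A.mulVecLin →ₗ[ℝ] ℝ :=
    (LinearMap.proj ⟨j, by simpa using hj⟩).comp (LinearMap.ker A.mulVecLin).subtype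
  have hdim : Module.finrank ℝ ℝ < Module.finrank ℝ (LinearMap.ker A.mulVecLin) := by
    have h := A.mulVecLin.finrank_range_add_finrank_ker
    have hcard : Fintype.card ({i}ᶜ : Finset (Fin n)) = n - 1 := by
      simp
    rw [Module.finrank_fintype_fun_eq_card, hcard] at h
    change A.rank + _ = _ at h
    rw [Module.finrank_self]
    omega
  obtain ⟨⟨v, hv⟩, hvev, hv0⟩ :=
    (Submodule.ne_bot_iff _).mp (ev.ker_ne_bot_of_finrank_lt hdim)
  let w : Fin n → ℝ := fun k => if hk : k ∈ ({i}ᶜ : Finset (Fin n)) then v ⟨k, hk⟩ else 0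
  have hwv : (fun k : ({i}ᶜ : Finset (Fin n)) => w k) = v := by
    ext k
    simp only [w, k.2, dite_true]
  have hwi : w i = 0 := by simp [w]
  have hwj : w j = 0 := by
    have : v ⟨j, by simpa using hj⟩ = 0 := hvev
    simpa [w] using fun _ => this
  have hAv : A *ᵥ v = 0 := hv
  have hMi : ∀ l, l ≠ i → (M *ᵥ w) l = 0 := fun l hl => by
    rw [← principalSub_compl_singleton_mulVec M hwi ⟨l, by simpa using hl⟩, hwv, hAv]
    rfl
  have hq : w ⬝ᵥ (M *ᵥ w) = 0 := by
    rw [← dotProduct_principalSub_compl_singleton_mulVec M hwi, hwv, hAv, dotProduct_zero]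
  have hMj := ((hM.posSemidef_compl_singleton j).dotProduct_mulVec_zero_iff (fun k => w k)).mp
    (by rw [star_trivial, dotProduct_principalSub_compl_singleton_mulVec M hwj, hq])
  refine ⟨w, fun h0 => hv0 ?_, funext fun l => ?_⟩
  · ext k
    simp [← hwv, h0]
  · by_cases hl : l = i
    · subst hl
      rw [← principalSub_compl_singleton_mulVec M hwj ⟨l, by simpa using hj.symm⟩, hMj]
      rfl
    · exact hMi l hl

/-- A positive semidefinite matrix of rank greater than one does not span an extreme ray
of any `S⁺(n,k)`. -/
theorem not_spansExtremeRay_of_posSemidef {n : ℕ} (k : ℕ) {M : Matrix (Fin n) (Fin n) ℝ}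
    (hM : M.PosSemidef) (hrank : 1 < M.rank) : ¬ SpansExtremeRay k M := by
  rintro ⟨hM0, -, hext⟩
  obtain ⟨m, v, hsum⟩ := posSemidef_iff_eq_sum_vecMulVec.mp hM
  simp only [star_trivial] at hsum
  have hpsd : ∀ l, (vecMulVec (v l) (v l)).PosSemidef := fun l => by
    simpa using posSemidef_vecMulVec_self_star (v l)
  obtain ⟨l, hl⟩ : ∃ l, v l ≠ 0 := by
    by_contra! h
    exact hM0 (by simp [hsum, h])
  obtain ⟨⟨a, -, ha⟩, -⟩ := hext (vecMulVec (v l) (v l))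
    (∑ j ∈ Finset.univ.erase l, vecMulVec (v j) (v j))
    (memPSDClosure_of_posSemidef k (hpsd l))
    (memPSDClosure_of_posSemidef k (posSemidef_sum _ fun j _ => hpsd j))
    (by rw [hsum, Finset.add_sum_erase _ (fun j => vecMulVec (v j) (v j)) (Finset.mem_univ l)])
  have ha0 : a ≠ 0 := by
    rintro rfl
    rw [zero_smul, vecMulVec_eq_zero, or_self] at ha
    exact hl ha
  have hM1 : M = vecMulVec (a⁻¹ • v l) (v l) := by
    rw [smul_vecMulVec, ha, smul_smul, inv_mul_cancel₀ ha0, one_smul]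
  rw [hM1] at hrank
  exact absurd (rank_vecMulVec_le _ _) (not_le.mpr hrank)

/-- If `M ∈ S⁺(n,n-1)` with `rank M > 1`, and some `(n-1) × (n-1)` principal
submatrix (deleting row and column `i`) has rank strictly less than `n-2`, then `M` does
not span an extreme ray of `S⁺(n,n-1)`. -/
theorem stmt8 {n : ℕ} (hn : 3 ≤ n) (M : Matrix (Fin n) (Fin n) ℝ)
    (hM : memPSDClosure (n - 1) M) (hrank : 1 < M.rank)
    (h : ∃ i : Fin n, (principalSub M ({i}ᶜ : Finset (Fin n))).rank < n - 2) :
    ¬ SpansExtremeRay (n - 1) M := by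
  obtain ⟨i, hi⟩ := h
  obtain ⟨w, hw, hMw⟩ := hM.exists_mulVec_eq_zero hn hi
  exact not_spansExtremeRay_of_posSemidef _ (hM.posSemidef_of_mulVec_eq_zero hw hMw) hrank
end

section
/- Let n ≥ 3 and let M ∈ S⁺(n,n−1). If there exists i ∈ {1,…,n} such that the (n−1)×(n−1) principal submatrix of M obtained by deleting row i and column i has rank strictly less than n−2, then det(M) = 0 and M is positive semidefinite. -/
open Matrix

theorem sum_coe_eq_of_eq_zero_off {n : ℕ} (I : Finset (Fin n)) (f : Fin n → ℝ)
    (hf : ∀ j ∉ I, f j = 0) : ∑ j : I, f j = ∑ j, f j := by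
  rw [Finset.sum_coe_sort I f]
  exact Finset.sum_subset (Finset.subset_univ I) fun j _ hj => hf j hj

theorem principalSub_mulVec_of_eq_zero_off {n : ℕ} (M : Matrix (Fin n) (Fin n) ℝ)
    (I : Finset (Fin n)) (x : Fin n → ℝ) (hx : ∀ j ∉ I, x j = 0) (k : I) :
    (principalSub M I *ᵥ fun j => x j) k = (M *ᵥ x) k :=
  sum_coe_eq_of_eq_zero_off I (fun j => M k j * x j) fun j hj => by simp [hx j hj]

theorem dotProduct_mulVec_nonneg_of_eq_zero_off {n : ℕ} (M : Matrix (Fin n) (Fin n) ℝ)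
    (I : Finset (Fin n)) (hI : (principalSub M I).PosSemidef) (x : Fin n → ℝ)
    (hx : ∀ j ∉ I, x j = 0) : 0 ≤ x ⬝ᵥ M *ᵥ x := by
  have h := hI.dotProduct_mulVec_nonneg fun j => x j
  have key : ∑ k : I, x k * (M *ᵥ x) k = x ⬝ᵥ M *ᵥ x :=
    sum_coe_eq_of_eq_zero_off I (fun k => x k * (M *ᵥ x) k) fun j hj => by simp [hx j hj]
  rw [← key]
  simpa [dotProduct, principalSub_mulVec_of_eq_zero_off M I x hx] using h

/-- A principal submatrix of corank at least two yields a nonzero kernel vector of the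
whole matrix. -/
theorem exists_mulVec_eq_zero_of_rank_lt {n : ℕ} (M : Matrix (Fin n) (Fin n) ℝ) (i : Fin n)
    (h : (principalSub M ({i}ᶜ : Finset (Fin n))).rank < n - 2) :
    ∃ v ≠ 0, M *ᵥ v = 0 := by
  set I : Finset (Fin n) := {i}ᶜ with hI
  set N := principalSub M I with hN
  let K := LinearMap.ker N.mulVecLin
  let φ : (I → ℝ) →ₗ[ℝ] ℝ := dotProductBilin ℝ ℝ fun j => M i j
  have hdim : Module.finrank ℝ ℝ < Module.finrank ℝ K := by
    have hrn := N.mulVecLin.finrank_range_add_finrank_ker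
    have hcard : I.card = n - 1 := by simp [hI, Finset.card_compl]
    rw [Module.finrank_fintype_fun_eq_card, Fintype.card_coe, hcard] at hrn
    rw [Module.finrank_self]
    change N.rank + Module.finrank ℝ K = _ at hrn
    omega
  obtain ⟨u, hu, hu0⟩ := Submodule.exists_mem_ne_zero_of_ne_bot
    (LinearMap.ker_ne_bot_of_finrank_lt (f := φ.comp K.subtype) hdim)
  have hφ : ∑ j : I, M i j * u.1 j = 0 := hu
  have hker : N *ᵥ u.1 = 0 := u.2
  let v : Fin n → ℝ := fun j => if hj : j ∈ I then u.1 ⟨j, hj⟩ else 0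
  have hv : ∀ j ∉ I, v j = 0 := fun j hj => dif_neg hj
  have hvu : (fun j : I => v j) = u.1 := by
    ext j
    simp [v]
  refine ⟨v, ?_, ?_⟩
  · intro hv0
    apply hu0
    ext j
    simp [← hvu, hv0]
  · ext k
    by_cases hk : k ∈ I
    · have := principalSub_mulVec_of_eq_zero_off M I v hv ⟨k, hk⟩
      rw [hvu, ← hN, hker] at this
      exact this.symm
    · obtain rfl : k = i := by simpa [hI] using hk
      rw [← hvu] at hφ
      rw [sum_coe_eq_of_eq_zero_off I (fun j => M k j * v j)
        fun j hj => by simp [hv j hj]] at hφ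
      exact hφ

/-- If `M ∈ S⁺(n,n-1)` and some `(n-1) × (n-1)` principal submatrix
(deleting row and column `i`) has rank strictly less than `n-2`, then `det M = 0` and
`M` is positive semidefinite. -/
theorem stmt9 {n : ℕ} (hn : 3 ≤ n) (M : Matrix (Fin n) (Fin n) ℝ)
    (hM : memPSDClosure (n - 1) M)
    (h : ∃ i : Fin n, (principalSub M ({i}ᶜ : Finset (Fin n))).rank < n - 2) :
    M.det = 0 ∧ M.PosSemidef := by
  obtain ⟨i, hi⟩ := h
  obtain ⟨v, hv0, hv⟩ := exists_mulVec_eq_zero_of_rank_lt M i hi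
  refine ⟨exists_mulVec_eq_zero_iff.mp ⟨v, hv0, hv⟩, ?_⟩
  refine PosSemidef.of_dotProduct_mulVec_nonneg ?_ fun x => ?_
  · rw [IsHermitian, conjTranspose_eq_transpose_of_trivial]
    exact hM.1
  obtain ⟨j, hj⟩ := Function.ne_iff.mp hv0
  have hj : v j ≠ 0 := hj
  have hvM : v ᵥ* M = 0 := by rw [← mulVec_transpose, hM.1.eq, hv]
  have h := dotProduct_mulVec_nonneg_of_eq_zero_off M {j}ᶜ
    (hM.2 _ (by simp [Finset.card_compl])) (x - (x j / v j) • v) (by simp [hj])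
  simpa [mulVec_sub, mulVec_smul, hv, sub_dotProduct, dotProduct_mulVec v, hvM] using h
end

section
/- Let n ≥ 3 and let M ∈ S⁺(n,n−1) be such that every (n−1)×(n−1) principal submatrix of M has rank at least n−2. If M has at least one (n−1)×(n−1) principal submatrix of full rank n−1, then M does not span an extreme ray of S⁺(n,n−1). -/
open Matrix

/-- A rank-one downdate `A - ε (A z) (A z)ᵀ` of a positive semidefinite matrix stays positive
semidefinite as long as `ε * zᵀ A z ≤ 1`. -/
theorem Matrix.PosSemidef.sub_smul_vecMulVec_mulVec {ι : Type*} [Fintype ι]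
    {A : Matrix ι ι ℝ} (hA : A.PosSemidef) {ε : ℝ} (hε : 0 ≤ ε) (z : ι → ℝ)
    (hz : ε * (z ⬝ᵥ A *ᵥ z) ≤ 1) :
    (A - ε • vecMulVec (A *ᵥ z) (A *ᵥ z)).PosSemidef := by
  have hsymm : Aᵀ = A := by simpa [conjTranspose_eq_transpose_of_trivial] using hA.isHermitian.eq
  refine PosSemidef.of_dotProduct_mulVec_nonneg ?_ fun x => ?_
  · rw [IsHermitian, conjTranspose_eq_transpose_of_trivial, transpose_sub, transpose_smul,
      transpose_vecMulVec, hsymm]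
  · set b : ℝ := x ⬝ᵥ A *ᵥ z with hb
    have hb' : z ⬝ᵥ A *ᵥ x = b := by
      rw [hb, dotProduct_mulVec, ← mulVec_transpose, hsymm, dotProduct_comm]
    have hx := hA.dotProduct_mulVec_nonneg (x - (ε * b) • z)
    have hxz : (A *ᵥ z) ⬝ᵥ x = b := by rw [dotProduct_comm]
    simp only [star_trivial, mulVec_sub, mulVec_smul, sub_dotProduct, dotProduct_sub,
      smul_dotProduct, dotProduct_smul, smul_eq_mul, hb', ← hb] at hx
    simp only [star_trivial, sub_mulVec, smul_mulVec, vecMulVec_mulVec, dotProduct_sub,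
      dotProduct_smul, hxz, op_smul_eq_smul, smul_eq_mul, ← hb]
    nlinarith [mul_nonneg (mul_nonneg hε (mul_self_nonneg b)) (sub_nonneg.2 hz)]

theorem principalSub_sub_smul_vecMulVec {n : ℕ} (M : Matrix (Fin n) (Fin n) ℝ) (ε : ℝ)
    (u : Fin n → ℝ) (I : Finset (Fin n)) :
    principalSub (M - ε • vecMulVec u u) I =
      principalSub M I - ε • vecMulVec (fun i : I => u i) (fun i : I => u i) := by
  ext i j
  simp [principalSub, vecMulVec_apply]

theorem memPSDClosure_of_posSemidef_s10 {n k : ℕ} {X : Matrix (Fin n) (Fin n) ℝ}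
    (hX : X.PosSemidef) : memPSDClosure k X :=
  ⟨by simpa [IsSymm, conjTranspose_eq_transpose_of_trivial] using hX.isHermitian.eq,
    fun _ _ => hX.submatrix _⟩

/-- If a rank-one matrix can be split off `X` inside the closure, and `X` has a principal
submatrix of rank at least two, then `X` does not span an extreme ray. -/
theorem not_spansExtremeRay_of_sub_vecMulVec {n k : ℕ} {X : Matrix (Fin n) (Fin n) ℝ}
    {I : Finset (Fin n)} (hI : 2 ≤ (principalSub X I).rank) {ε : ℝ} (hε : 0 < ε)
    {u : Fin n → ℝ} (hu : u ≠ 0) (hX : memPSDClosure k (X - ε • vecMulVec u u)) :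
    ¬ SpansExtremeRay k X := by
  rintro ⟨-, -, h⟩
  have hpsd : (ε • vecMulVec u u).PosSemidef := by
    simpa using (posSemidef_vecMulVec_self_star u).smul hε.le
  obtain ⟨-, b, -, hb⟩ := h _ _ hX (memPSDClosure_of_posSemidef_s10 hpsd) (sub_add_cancel _ _).symm
  have hb0 : b ≠ 0 := by
    rintro rfl
    obtain ⟨i, hi⟩ := Function.ne_iff.1 hu
    have := congrFun (congrFun hb i) i
    simp [vecMulVec_apply, hε.ne'] at this
    exact hi this
  have hXu : principalSub X I =
      vecMulVec (fun i : I => b⁻¹ * ε * u i) (fun i : I => u i) := by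
    ext i j
    have := congrFun (congrFun hb i) j
    simp only [Matrix.smul_apply, vecMulVec_apply, smul_eq_mul] at this
    simp only [principalSub, submatrix_apply, vecMulVec_apply]
    field_simp
    linarith
  rw [hXu] at hI
  have := rank_vecMulVec_le (fun i : I => b⁻¹ * ε * u i) (fun i : I => u i)
  omega

/-- A symmetric matrix with a zero column `i₀` is positive semidefinite as soon as the principal
submatrix avoiding `i₀` is. -/
theorem posSemidef_of_col_eq_zero {n : ℕ} {M : Matrix (Fin n) (Fin n) ℝ} (hM : M.IsSymm)
    {i₀ : Fin n} (h0 : ∀ i, M i i₀ = 0) {I : Finset (Fin n)} (hI : I = Finset.univ.erase i₀)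
    (hpsd : (principalSub M I).PosSemidef) : M.PosSemidef := by
  refine PosSemidef.of_dotProduct_mulVec_nonneg
    (by rwa [IsHermitian, conjTranspose_eq_transpose_of_trivial]) fun x => ?_
  have h0' : ∀ j, M i₀ j = 0 := fun j => by rw [← hM.apply, h0]
  have h := hpsd.dotProduct_mulVec_nonneg (fun i : I => x i)
  convert h using 1
  have hsum : ∀ f : Fin n → ℝ, f i₀ = 0 → ∑ i, f i = ∑ i : I, f i := fun f hf => by
    rw [Finset.sum_coe_sort I f, hI, Finset.sum_erase _ hf]
  simp only [dotProduct, mulVec, principalSub, submatrix_apply, Pi.star_apply, star_trivial]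
  rw [hsum _ (by simp [h0'])]
  refine Finset.sum_congr rfl fun i _ => ?_
  rw [hsum _ (by simp [h0])]

/-- If `M ∈ S⁺(n,n-1)`, every `(n-1) × (n-1)` principal submatrix of `M`
has rank at least `n-2`, and some `(n-1) × (n-1)` principal submatrix has full rank
`n-1`, then `M` does not span an extreme ray of `S⁺(n,n-1)`. -/
theorem stmt10 {n : ℕ} (hn : 3 ≤ n) (M : Matrix (Fin n) (Fin n) ℝ)
    (hM : memPSDClosure (n - 1) M)
    (hrank : ∀ I : Finset (Fin n), I.card = n - 1 → n - 2 ≤ (principalSub M I).rank)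
    (hfull : ∃ I : Finset (Fin n), I.card = n - 1 ∧ (principalSub M I).rank = n - 1) :
    ¬ SpansExtremeRay (n - 1) M := by
  obtain ⟨I₀, hI₀, hr⟩ := hfull
  have hunit : IsUnit (principalSub M I₀) := by
    rw [← mulVec_surjective_iff_isUnit]
    refine (fun htop : LinearMap.range (principalSub M I₀).mulVecLin = ⊤ =>
      LinearMap.range_eq_top.1 htop) (Submodule.eq_top_of_finrank_eq ?_)
    rw [← Matrix.rank, hr, Module.finrank_fintype_fun_eq_card, Fintype.card_coe, hI₀]
  have h2 : 2 ≤ (principalSub M I₀).rank := by omega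
  have hsymm := hM.1
  obtain ⟨i₀, hi₀⟩ : ∃ i, i ∉ I₀ := by
    by_contra! h
    have := Finset.card_univ (α := Fin n)
    rw [← Finset.eq_univ_iff_forall.2 h, Fintype.card_fin] at this
    omega
  have herase : ∀ I : Finset (Fin n), I.card = n - 1 → i₀ ∉ I → I = Finset.univ.erase i₀ :=
    fun I hI h => Finset.eq_of_subset_of_card_le
      (fun i hi => Finset.mem_erase.2 ⟨fun e => h (e ▸ hi), Finset.mem_univ _⟩) (by simp [hI])
  have hdiag : ∀ (I : Finset (Fin n)), I.card = n - 1 → ∀ i ∈ I, 0 ≤ M i i :=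
    fun I hI i hi => (hM.2 I hI).diag_nonneg (i := ⟨i, hi⟩)
  by_cases hw : (fun i => M i i₀) = 0
  · have hpsd : M.PosSemidef := posSemidef_of_col_eq_zero hsymm (congrFun hw)
      (herase I₀ hI₀ hi₀) (hM.2 I₀ hI₀)
    obtain ⟨i₁, hi₁⟩ : I₀.Nonempty := Finset.card_pos.1 (by omega)
    have hd := hdiag I₀ hI₀ i₁ hi₁
    refine not_spansExtremeRay_of_sub_vecMulVec h2 (ε := (1 + M i₁ i₁)⁻¹) (by positivity)
      (u := M *ᵥ Pi.single i₁ 1) (fun h => ?_)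
      (memPSDClosure_of_posSemidef_s10 (hpsd.sub_smul_vecMulVec_mulVec (by positivity) _ ?_))
    · have hinj := mulVec_injective_of_isUnit hunit
      have : principalSub M I₀ *ᵥ Pi.single ⟨i₁, hi₁⟩ 1 = principalSub M I₀ *ᵥ 0 := by
        ext i
        simpa [principalSub] using congrFun h i
      simpa using congrFun (hinj this) ⟨i₁, hi₁⟩
    · simp only [mulVec_single_one, single_one_dotProduct, col_apply]
      rw [inv_mul_le_iff₀ (by positivity)]
      linarith
  · obtain ⟨z, hz⟩ := mulVec_surjective_iff_isUnit.2 hunit (fun i : I₀ => M i i₀)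
    have hc : 0 ≤ z ⬝ᵥ principalSub M I₀ *ᵥ z := by
      simpa using (hM.2 I₀ hI₀).dotProduct_mulVec_nonneg z
    set c := z ⬝ᵥ principalSub M I₀ *ᵥ z with hcdef
    have hpos : 0 < 1 + |M i₀ i₀| + c := by positivity
    refine not_spansExtremeRay_of_sub_vecMulVec h2 (inv_pos.2 hpos) hw ⟨?_, fun I hI => ?_⟩
    · rw [IsSymm, transpose_sub, transpose_smul, transpose_vecMulVec, hsymm]
    · rw [principalSub_sub_smul_vecMulVec]
      by_cases hi : i₀ ∈ I
      · have hcol : (fun i : I => M i i₀) = principalSub M I *ᵥ Pi.single ⟨i₀, hi⟩ 1 := by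
          ext i
          simp [principalSub]
        rw [hcol]
        refine (hM.2 I hI).sub_smul_vecMulVec_mulVec (by positivity) _ ?_
        rw [← hcol, single_one_dotProduct, inv_mul_le_iff₀ hpos]
        linarith [le_abs_self (M i₀ i₀)]
      · obtain rfl : I = I₀ := (herase I hI hi).trans (herase I₀ hI₀ hi₀).symm
        rw [← hz]
        refine (hM.2 I hI).sub_smul_vecMulVec_mulVec (by positivity) _ ?_
        rw [← hcdef, inv_mul_le_iff₀ hpos]
        linarith [abs_nonneg (M i₀ i₀)]
end

section
/- Let n ≥ 3 and let M ∈ S⁺(n,n−1) be such that every (n−1)×(n−1) principal submatrix of M has rank exactly n−2 and det(M) < 0. Suppose M = A + B with A, B ∈ S⁺(n,n−1). Then there exist n linearly independent vectors v¹, …, vⁿ ∈ ℝⁿ such that for each i ∈ {1,…,n}, writing Jᵢ = {1,…,n} \ {i}, the i-th coordinate of vⁱ is zero and the restriction of vⁱ to Jᵢ lies in the kernel of each of the principal submatrices M_{Jᵢ}, A_{Jᵢ}, and B_{Jᵢ}. -/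
open Matrix

/-- A vector in the kernel of a sum of two positive semidefinite matrices lies in the kernel of
the first summand. -/
lemma Matrix.PosSemidef.mulVec_eq_zero_of_add {m : Type*} [Fintype m] {P Q : Matrix m m ℝ}
    (hP : P.PosSemidef) (hQ : Q.PosSemidef) {x : m → ℝ} (h : (P + Q) *ᵥ x = 0) :
    P *ᵥ x = 0 := by
  rw [← hP.dotProduct_mulVec_zero_iff]
  have hsum : star x ⬝ᵥ P *ᵥ x + star x ⬝ᵥ Q *ᵥ x = 0 := by
    rw [← dotProduct_add, ← add_mulVec, h, dotProduct_zero]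
  linarith [hP.dotProduct_mulVec_nonneg x, hQ.dotProduct_mulVec_nonneg x]

/-- A square real matrix whose rank is less than its size has a nonzero kernel vector. -/
lemma Matrix.exists_mulVec_eq_zero_of_rank_lt {m : Type*} [Fintype m] [DecidableEq m]
    {P : Matrix m m ℝ} (h : P.rank < Fintype.card m) : ∃ x ≠ 0, P *ᵥ x = 0 := by
  rw [exists_mulVec_eq_zero_iff]
  by_contra hd
  exact h.ne (rank_of_isUnit P ((isUnit_iff_isUnit_det P).2 (isUnit_iff_ne_zero.2 hd)))

/-- If `v i` is nonzero and `M *ᵥ v i` vanishes off the coordinate `i` for every `i`, where `M` is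
nonsingular, then the vectors `v i` are linearly independent. -/
lemma Matrix.linearIndependent_of_mulVec_apply_eq_zero {m : Type*} [Fintype m] [DecidableEq m]
    {M : Matrix m m ℝ} (hM : M.det ≠ 0) {v : m → m → ℝ} (hv : ∀ i, v i ≠ 0)
    (h : ∀ i j, j ≠ i → (M *ᵥ v i) j = 0) : LinearIndependent ℝ v := by
  have hc (i : m) : (M *ᵥ v i) i ≠ 0 := fun hi =>
    hv i <| eq_zero_of_mulVec_eq_zero hM <| funext fun j => by
      obtain rfl | hj := eq_or_ne j i
      exacts [hi, h i j hj]
  rw [Fintype.linearIndependent_iff]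
  intro g hg k
  have hk : ∑ i, g i * (M *ᵥ v i) k = 0 := by
    simpa [mulVec_sum, mulVec_smul] using congrFun (congrArg (M *ᵥ ·) hg) k
  rw [Finset.sum_eq_single k (fun i _ hi => by rw [h i k hi.symm, mul_zero]) (by simp)] at hk
  exact (mul_eq_zero.1 hk).resolve_right (hc k)

/-- If `x` vanishes off `I`, then `X *ᵥ x` agrees on `I` with the product of the principal
submatrix of `X` and the restriction of `x`. -/
lemma principalSub_mulVec_apply {n : ℕ} (X : Matrix (Fin n) (Fin n) ℝ) {I : Finset (Fin n)}
    {x : Fin n → ℝ} (hx : ∀ j ∉ I, x j = 0) (j : I) :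
    (principalSub X I *ᵥ fun k : I => x k) j = (X *ᵥ x) j := by
  simp only [mulVec, dotProduct, principalSub, submatrix_apply]
  rw [Finset.sum_coe_sort I fun k => X j k * x k]
  exact Finset.sum_subset (Finset.subset_univ I) fun k _ hk => by rw [hx k hk, mul_zero]

/-- Suppose `M ∈ S⁺(n,n-1)`, every `(n-1) × (n-1)` principal submatrix of
`M` has rank exactly `n-2`, `det M < 0`, and `M = A + B` with `A, B ∈ S⁺(n,n-1)`. Then
there are `n` linearly independent vectors `v¹, …, vⁿ` with `vⁱᵢ = 0` and the restriction
of `vⁱ` to `Jᵢ = {1,…,n} \ {i}` in the kernel of `M_{Jᵢ}`, `A_{Jᵢ}` and `B_{Jᵢ}`. -/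
theorem stmt11 {n : ℕ} (hn : 3 ≤ n) (M A B : Matrix (Fin n) (Fin n) ℝ)
    (hM : memPSDClosure (n - 1) M)
    (hA : memPSDClosure (n - 1) A) (hB : memPSDClosure (n - 1) B)
    (hrank : ∀ I : Finset (Fin n), I.card = n - 1 → (principalSub M I).rank = n - 2)
    (hdet : M.det < 0) (hMAB : M = A + B) :
    ∃ v : Fin n → Fin n → ℝ, LinearIndependent ℝ v ∧
      ∀ i : Fin n, v i i = 0 ∧
        (principalSub M ({i}ᶜ : Finset (Fin n))).mulVec
          (fun j : ({i}ᶜ : Finset (Fin n)) => v i (j : Fin n)) = 0 ∧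
        (principalSub A ({i}ᶜ : Finset (Fin n))).mulVec
          (fun j : ({i}ᶜ : Finset (Fin n)) => v i (j : Fin n)) = 0 ∧
        (principalSub B ({i}ᶜ : Finset (Fin n))).mulVec
          (fun j : ({i}ᶜ : Finset (Fin n)) => v i (j : Fin n)) = 0 := by
  have hcard (i : Fin n) : ({i}ᶜ : Finset (Fin n)).card = n - 1 := by
    simp [Finset.card_compl]
  have hker (i : Fin n) : ∃ x : Fin n → ℝ, x ≠ 0 ∧ x i = 0 ∧
      (principalSub M ({i}ᶜ : Finset (Fin n)) *ᵥ
        fun j : ({i}ᶜ : Finset (Fin n)) => x j) = 0 := by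
    obtain ⟨w, hw, hw0⟩ := exists_mulVec_eq_zero_of_rank_lt
      (P := principalSub M ({i}ᶜ : Finset (Fin n))) (by
        rw [hrank _ (hcard i), Fintype.card_coe, hcard i]; omega)
    have hext : (fun j : ({i}ᶜ : Finset (Fin n)) =>
        if hj : (j : Fin n) ∈ ({i}ᶜ : Finset (Fin n)) then w ⟨j, hj⟩ else 0) = w :=
      funext fun j => dif_pos j.2
    refine ⟨fun j => if hj : j ∈ ({i}ᶜ : Finset (Fin n)) then w ⟨j, hj⟩ else 0,
      fun h0 => hw ?_, by simp, by rw [hext, hw0]⟩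
    rw [← hext]
    exact funext fun j => congrFun h0 j
  choose v hv hvi hMv using hker
  refine ⟨v, linearIndependent_of_mulVec_apply_eq_zero hdet.ne hv fun i j hj => ?_,
    fun i => ⟨hvi i, hMv i, ?_, ?_⟩⟩
  · rw [← principalSub_mulVec_apply M (I := {i}ᶜ) (fun k hk => by
      obtain rfl : k = i := by simpa using hk
      exact hvi k) ⟨j, by simpa using hj⟩, hMv i, Pi.zero_apply]
  · subst hMAB
    exact (hA.2 _ (hcard i)).mulVec_eq_zero_of_add (hB.2 _ (hcard i)) (hMv i)
  · rw [add_comm] at hMAB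
    subst hMAB
    exact (hB.2 _ (hcard i)).mulVec_eq_zero_of_add (hA.2 _ (hcard i)) (hMv i)
end

section
/- Let n ≥ 3 and let M ∈ S⁺(n,n−1) with det(M) < 0. Define the graph G_M on vertex set {1,…,n} with an edge between distinct vertices i and j whenever M(i,j) ≠ 0. Then G_M is a connected graph. -/
open Matrix

/-- If every principal submatrix of `M` of size `n - 1` is positive semidefinite, then so is
the principal block of `M` indexed by any predicate that is not always true. -/
theorem memPSDClosure.posSemidef_toSquareBlockProp {n : ℕ} {M : Matrix (Fin n) (Fin n) ℝ}
    (hM : memPSDClosure (n - 1) M) {p : Fin n → Prop} {v : Fin n} (hv : ¬ p v) :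
    (M.toSquareBlockProp p).PosSemidef := by
  have h := hM.2 (Finset.univ.erase v) (by simp)
  exact h.submatrix fun i : {i // p i} =>
    ⟨i, Finset.mem_erase.2 ⟨fun h => hv (h ▸ i.2), Finset.mem_univ _⟩⟩

/-- If `n ≥ 3`, `M ∈ S⁺(n,n-1)` and `det M < 0`, then the graph on
`{1,…,n}` joining distinct `i, j` whenever `M i j ≠ 0` is connected. -/
theorem stmt14 {n : ℕ} (hn : 3 ≤ n) (M : Matrix (Fin n) (Fin n) ℝ)
    (hM : memPSDClosure (n - 1) M) (hdet : M.det < 0) :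
    (SimpleGraph.fromRel (fun i j : Fin n => M i j ≠ 0)).Connected := by
  classical
  set G := SimpleGraph.fromRel (fun i j : Fin n => M i j ≠ 0) with hG
  have : Nonempty (Fin n) := ⟨⟨0, by omega⟩⟩
  refine ⟨fun u v => ?_⟩
  by_contra huv
  have hblock : ∀ i, ¬ G.Reachable u i → ∀ j, G.Reachable u j → M i j = 0 := by
    intro i hi j hj
    by_contra hij
    have hne : j ≠ i := fun h => hi (h ▸ hj)
    have hadj : G.Adj j i := by
      rw [hG, SimpleGraph.fromRel_adj]
      exact ⟨hne, Or.inr hij⟩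
    exact hi (hj.trans hadj.reachable)
  rw [Matrix.twoBlockTriangular_det M (fun i => G.Reachable u i) hblock] at hdet
  have hu : ¬ ¬ G.Reachable u u := not_not.2 (SimpleGraph.Reachable.refl u)
  exact hdet.not_ge (mul_nonneg (hM.posSemidef_toSquareBlockProp huv).det_nonneg
    (hM.posSemidef_toSquareBlockProp (p := fun i => ¬ G.Reachable u i) hu).det_nonneg)
end

section
/- For n ≥ 3, the matrix G(n,n−1) = ((n−1)/(n−2))·I − (1/(n−2))·J, where I is the n×n identity matrix and J is the n×n all-ones matrix, spans an extreme ray of the (n−1)-PSD closure S⁺(n,n−1). -/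
open Matrix

theorem Gmat_apply (n k : ℕ) (i j : Fin n) :
    Gmat n k i j = (k : ℝ) / (k - 1) * (if i = j then 1 else 0) - 1 / (k - 1) := by
  simp [Gmat, Matrix.one_apply]

theorem sum_Gmat_mul {n : ℕ} (k : ℕ) (I : Finset (Fin n)) (x : I → ℝ) (i : I) :
    ∑ j : I, Gmat n k i j * x j = (k : ℝ) / (k - 1) * x i - 1 / (k - 1) * ∑ j, x j := by
  simp only [Gmat_apply, sub_mul, Finset.sum_sub_distrib, Finset.mul_sum, Subtype.coe_inj,
    mul_ite, ite_mul, mul_one, mul_zero, zero_mul, Finset.sum_ite_eq, Finset.mem_univ, if_true]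

theorem memPSDClosure_Gmat (n : ℕ) {k : ℕ} (hk : 2 ≤ k) : memPSDClosure k (Gmat n k) := by
  have hk' : (2 : ℝ) ≤ k := by exact_mod_cast hk
  have hsymm : (Gmat n k).IsSymm := by
    ext i j
    simp [Gmat_apply, eq_comm]
  refine ⟨hsymm, fun I hI => ?_⟩
  refine Matrix.PosSemidef.of_dotProduct_mulVec_nonneg ?_ fun x => ?_
  · ext i j
    simpa [principalSub] using hsymm.apply (i : Fin n) j
  · have hcs := sq_sum_le_card_mul_sum_sq (s := (Finset.univ : Finset I)) (f := x)
    rw [Finset.card_univ, Fintype.card_coe, hI] at hcs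
    have hform : star x ⬝ᵥ (principalSub (Gmat n k) I *ᵥ x) =
        1 / ((k : ℝ) - 1) * (k * ∑ i, x i ^ 2 - (∑ i, x i) ^ 2) := by
      have hrow (i : I) : (principalSub (Gmat n k) I *ᵥ x) i =
          (k : ℝ) / (k - 1) * x i - 1 / (k - 1) * ∑ j, x j := sum_Gmat_mul k I x i
      simp only [dotProduct, hrow, star_trivial, mul_sub, Finset.sum_sub_distrib]
      have hsq : ∑ i, x i * ((k : ℝ) / (k - 1) * x i) = (k : ℝ) / (k - 1) * ∑ i, x i ^ 2 := by
        rw [Finset.mul_sum]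
        exact Finset.sum_congr rfl fun i _ => by ring
      rw [← Finset.sum_mul, hsq]
      ring
    rw [hform]
    exact mul_nonneg (one_div_nonneg.2 (by linarith)) (sub_nonneg.2 hcs)

theorem principalSub_Gmat_mulVec_one {n k : ℕ} {I : Finset (Fin n)} (hI : I.card = k) :
    principalSub (Gmat n k) I *ᵥ 1 = 0 := by
  ext i
  have h : (principalSub (Gmat n k) I *ᵥ 1) i = _ := sum_Gmat_mul k I 1 i
  rw [h]
  simp [hI]
  ring

theorem Matrix.PosSemidef.mulVec_eq_zero_of_add_s15 {ι : Type*} [Fintype ι] {A B : Matrix ι ι ℝ}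
    (hA : A.PosSemidef) (hB : B.PosSemidef) {x : ι → ℝ} (h : (A + B) *ᵥ x = 0) :
    A *ᵥ x = 0 := by
  rw [← hA.dotProduct_mulVec_zero_iff]
  have hsum : star x ⬝ᵥ (A *ᵥ x) + star x ⬝ᵥ (B *ᵥ x) = 0 := by
    rw [← dotProduct_add, ← add_mulVec, h, dotProduct_zero]
  linarith [hA.dotProduct_mulVec_nonneg x, hB.dotProduct_mulVec_nonneg x]

/-- A symmetric matrix whose principal submatrices of order `n - 1` all annihilate the all-ones
vector is a multiple of `G(n,n-1)`. -/
theorem eq_smul_Gmat {n : ℕ} (hn : 3 ≤ n) {A : Matrix (Fin n) (Fin n) ℝ} (hA : A.IsSymm)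
    (h : ∀ I : Finset (Fin n), I.card = n - 1 → principalSub A I *ᵥ 1 = 0) (i₀ : Fin n) :
    A = A i₀ i₀ • Gmat n (n - 1) := by
  have hcast : ((n - 1 : ℕ) : ℝ) = n - 1 := by rw [Nat.cast_sub (by omega), Nat.cast_one]
  have hn' : (3 : ℝ) ≤ n := by exact_mod_cast hn
  have hoff (i m : Fin n) (him : i ≠ m) : A i m = ∑ j, A i j := by
    have hI := congrFun (h (Finset.univ.erase m) (by simp))
      ⟨i, Finset.mem_erase.2 ⟨him, Finset.mem_univ i⟩⟩
    have hsum : ∑ j ∈ Finset.univ.erase m, A i j = 0 := by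
      rw [← Finset.sum_coe_sort]
      simpa [mulVec, dotProduct, principalSub] using hI
    rw [← Finset.add_sum_erase _ _ (Finset.mem_univ m), hsum, add_zero]
  have hrow (i j : Fin n) : ∑ l, A i l = ∑ l, A j l := by
    rcases eq_or_ne i j with rfl | hij
    · rfl
    · rw [← hoff i j hij, ← hoff j i hij.symm, hA.apply]
  have hdiag (i : Fin n) : A i i = -((n : ℝ) - 2) * ∑ l, A i l := by
    have hs := Finset.add_sum_erase Finset.univ (A i) (Finset.mem_univ i)
    rw [Finset.sum_congr rfl fun m hm => hoff i m (Finset.ne_of_mem_erase hm).symm,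
      Finset.sum_const, Finset.card_erase_of_mem (Finset.mem_univ i), Finset.card_univ,
      Fintype.card_fin, nsmul_eq_mul, hcast] at hs
    linarith
  have hne : (n : ℝ) - 1 - 1 ≠ 0 := by linarith
  ext i j
  rw [Matrix.smul_apply, smul_eq_mul, Gmat_apply, hcast, hdiag i₀, hrow i₀ i]
  rcases eq_or_ne i j with rfl | hij
  · rw [hdiag i, if_pos rfl]
    field_simp
  · rw [hoff i j hij, if_neg hij]
    field_simp
    ring

theorem memPSDClosure.diag_nonneg {n k : ℕ} {A : Matrix (Fin n) (Fin n) ℝ}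
    (hA : memPSDClosure k A) (hk : 1 ≤ k) (hkn : k ≤ n) (i : Fin n) : 0 ≤ A i i := by
  obtain ⟨I, hiI, -, hI⟩ := Finset.exists_subsuperset_card_eq
    (Finset.subset_univ {i}) (by simpa using hk) (by simpa using hkn)
  exact (hA.2 I hI).diag_nonneg (i := ⟨i, hiI (Finset.mem_singleton_self i)⟩)

theorem exists_eq_smul_Gmat_of_add {n : ℕ} (hn : 3 ≤ n) {A B : Matrix (Fin n) (Fin n) ℝ}
    (hA : memPSDClosure (n - 1) A) (hB : memPSDClosure (n - 1) B)
    (h : Gmat n (n - 1) = A + B) : ∃ a : ℝ, 0 ≤ a ∧ A = a • Gmat n (n - 1) := by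
  let i₀ : Fin n := ⟨0, by omega⟩
  refine ⟨A i₀ i₀, hA.diag_nonneg (by omega) (by omega) i₀, eq_smul_Gmat hn hA.1 ?_ i₀⟩
  intro I hI
  refine (hA.2 I hI).mulVec_eq_zero_of_add_s15 (hB.2 I hI) ?_
  have hG := principalSub_Gmat_mulVec_one hI
  rwa [h] at hG

/-- For `n ≥ 3`, the matrix `G(n,n-1)` spans an extreme ray of the
`(n-1)`-PSD closure `S⁺(n,n-1)`. -/
theorem stmt15 {n : ℕ} (hn : 3 ≤ n) :
    SpansExtremeRay (n - 1) (Gmat n (n - 1)) := by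
  refine ⟨fun h0 => ?_, memPSDClosure_Gmat n (by omega), fun A B hA hB h =>
    ⟨exists_eq_smul_Gmat_of_add hn hA hB h,
      exists_eq_smul_Gmat_of_add hn hB hA (h.trans (add_comm A B))⟩⟩
  have h01 := congrFun (congrFun h0 ⟨0, by omega⟩) ⟨1, by omega⟩
  have hn' : (2 : ℝ) ≤ (n - 1 : ℕ) := by exact_mod_cast (by omega : 2 ≤ n - 1)
  have hpos : 0 < 1 / (((n - 1 : ℕ) : ℝ) - 1) := one_div_pos.2 (by linarith)
  rw [Gmat_apply, if_neg (by simp), Matrix.zero_apply] at h01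
  linarith
end

section
/- For n ≥ 3, let G(n,n−1) = ((n−1)/(n−2))·I − (1/(n−2))·J, where I is the n×n identity matrix and J is the n×n all-ones matrix. Then det(G(n,n−1)) = −(1/(n−2))·((n−1)/(n−2))^{n−1} < 0, and every (n−1)×(n−1) principal submatrix of G(n,n−1) is positive semidefinite with rank exactly n−2. -/
open Matrix

/-- The orthogonal projection `1 - |ι|⁻¹ J` of `ℝ^ι` onto the complement of the constant vectors. -/
noncomputable def centeringMatrix (ι : Type*) [Fintype ι] [DecidableEq ι] : Matrix ι ι ℝ :=
  1 - (Fintype.card ι : ℝ)⁻¹ • Matrix.of fun _ _ => 1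

section Centering

variable {ι : Type*} [Fintype ι] [DecidableEq ι]

theorem centeringMatrix_mulVec_apply (v : ι → ℝ) (i : ι) :
    (centeringMatrix ι *ᵥ v) i = v i - (Fintype.card ι : ℝ)⁻¹ * ∑ j, v j := by
  rw [centeringMatrix, sub_mulVec, one_mulVec, smul_mulVec]
  simp [mulVec, dotProduct]

theorem centeringMatrix_isHermitian : (centeringMatrix ι).IsHermitian := by
  ext i j
  simp [centeringMatrix, one_apply, eq_comm]

theorem centeringMatrix_mul_self [Nonempty ι] :
    centeringMatrix ι * centeringMatrix ι = centeringMatrix ι := by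
  have h : (Fintype.card ι : ℝ) ≠ 0 := by simp
  refine ext_of_mulVec_single fun k => funext fun i => ?_
  rw [← mulVec_mulVec, centeringMatrix_mulVec_apply]
  simp only [centeringMatrix_mulVec_apply, Finset.sum_sub_distrib, Finset.sum_const,
    Finset.card_univ, nsmul_eq_mul]
  field_simp
  ring

theorem centeringMatrix_posSemidef [Nonempty ι] : (centeringMatrix ι).PosSemidef := by
  rw [← centeringMatrix_mul_self]
  nth_rewrite 1 [← centeringMatrix_isHermitian.eq]
  exact posSemidef_conjTranspose_mul_self _

theorem ker_centeringMatrix_mulVecLin [Nonempty ι] :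
    LinearMap.ker (centeringMatrix ι).mulVecLin = ℝ ∙ (1 : ι → ℝ) := by
  have h : (Fintype.card ι : ℝ) ≠ 0 := by simp
  ext v
  rw [LinearMap.mem_ker, Submodule.mem_span_singleton, mulVecLin_apply]
  constructor
  · intro hv
    refine ⟨(Fintype.card ι : ℝ)⁻¹ * ∑ j, v j, funext fun i => ?_⟩
    have hi := congrFun hv i
    rw [centeringMatrix_mulVec_apply, Pi.zero_apply, sub_eq_zero] at hi
    simp [hi]
  · rintro ⟨a, rfl⟩
    ext i
    simp [centeringMatrix_mulVec_apply, h]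

theorem rank_centeringMatrix [Nonempty ι] :
    (centeringMatrix ι).rank = Fintype.card ι - 1 := by
  have h := (centeringMatrix ι).mulVecLin.finrank_range_add_finrank_ker
  rw [ker_centeringMatrix_mulVecLin, finrank_span_singleton one_ne_zero,
    Module.finrank_fintype_fun_eq_card] at h
  exact Nat.eq_sub_of_add_eq h

end Centering

theorem det_Gmat {n k : ℕ} (hk : k ≠ 0) :
    (Gmat n k).det = ((k : ℝ) / (k - 1)) ^ n * (1 - n / k) := by
  have hk' : (k : ℝ) ≠ 0 := by exact_mod_cast hk
  have h : Gmat n k = ((k : ℝ) / (k - 1)) •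
      (1 + replicateCol Unit (fun _ : Fin n => -(k : ℝ)⁻¹) *
        replicateRow Unit (fun _ : Fin n => (1 : ℝ))) := by
    ext i j
    simp only [Gmat, Matrix.sub_apply, Matrix.add_apply, Matrix.smul_apply, of_apply, mul_apply, replicateCol_apply,
      replicateRow_apply, smul_eq_mul, Finset.univ_unique, Finset.sum_singleton]
    field_simp
    ring
  rw [h, det_smul, det_one_add_replicateCol_mul_replicateRow, Fintype.card_fin]
  simp [dotProduct, sub_eq_add_neg, div_eq_mul_inv]

theorem principalSub_Gmat {n k : ℕ} (hk : k ≠ 0) {I : Finset (Fin n)} (hI : I.card = k) :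
    principalSub (Gmat n k) I = ((k : ℝ) / (k - 1)) • centeringMatrix I := by
  have hk' : (k : ℝ) ≠ 0 := by exact_mod_cast hk
  ext i j
  simp only [principalSub, Gmat, centeringMatrix, submatrix_apply, Matrix.sub_apply, Matrix.smul_apply, of_apply,
    smul_eq_mul, Fintype.card_coe, hI, one_apply, Subtype.coe_inj]
  field_simp

/-- For `n ≥ 3`, `det G(n,n-1) = -(1/(n-2)) ((n-1)/(n-2))^(n-1) < 0`, and
every `(n-1) × (n-1)` principal submatrix of `G(n,n-1)` is positive semidefinite of rank
exactly `n-2`. -/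
theorem stmt16 {n : ℕ} (hn : 3 ≤ n) :
    (Gmat n (n - 1)).det
        = -(1 / ((n : ℝ) - 2)) * (((n : ℝ) - 1) / ((n : ℝ) - 2)) ^ (n - 1) ∧
      (Gmat n (n - 1)).det < 0 ∧
      ∀ I : Finset (Fin n), I.card = n - 1 →
        (principalSub (Gmat n (n - 1)) I).PosSemidef ∧
          (principalSub (Gmat n (n - 1)) I).rank = n - 2 := by
  obtain ⟨m, rfl⟩ : ∃ m, n = m + 3 := ⟨n - 3, by omega⟩
  have hm : (0 : ℝ) < m + 1 := by positivity
  have hk : m + 3 - 1 ≠ 0 := by omega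
  have hcast : ((m + 3 - 1 : ℕ) : ℝ) = m + 2 := by simp
  have hdet : (Gmat (m + 3) (m + 3 - 1)).det
      = -(1 / (((m + 3 : ℕ) : ℝ) - 2)) *
        ((((m + 3 : ℕ) : ℝ) - 1) / (((m + 3 : ℕ) : ℝ) - 2)) ^ (m + 3 - 1) := by
    have h1 : ((m + 3 : ℕ) : ℝ) - 1 = m + 2 := by push_cast; ring
    have h2 : ((m + 3 : ℕ) : ℝ) - 2 = m + 1 := by push_cast; ring
    have h3 : (m : ℝ) + 2 - 1 = m + 1 := by ring
    rw [det_Gmat hk, hcast, h1, h2, h3, Nat.add_sub_cancel (n := m + 2) (m := 1), pow_succ]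
    push_cast
    field_simp
    ring
  refine ⟨hdet, ?_, fun I hI => ?_⟩
  · rw [hdet, neg_mul, neg_lt_zero]
    have h1 : (0 : ℝ) < ((m + 3 : ℕ) : ℝ) - 1 := by push_cast; linarith
    have h2 : (0 : ℝ) < ((m + 3 : ℕ) : ℝ) - 2 := by push_cast; linarith
    positivity
  · have : Nonempty I := (Finset.card_ne_zero.mp (hI ▸ hk)).to_subtype
    have hc : (0 : ℝ) < ((m + 3 - 1 : ℕ) : ℝ) / (((m + 3 - 1 : ℕ) : ℝ) - 1) := by
      rw [hcast]
      exact div_pos (by linarith) (by linarith)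
    rw [principalSub_Gmat hk hI]
    refine ⟨centeringMatrix_posSemidef.smul hc.le, ?_⟩
    rw [rank_smul_of_mem_nonZeroDivisors _ (mem_nonZeroDivisors_of_ne_zero hc.ne'), rank_centeringMatrix, Fintype.card_coe, hI]
    omega
end

section
/- For integers n ≥ 3 and 2 ≤ k ≤ n−1, the matrix G(n,k) = (k/(k−1))·I − (1/(k−1))·J, where I is the n×n identity matrix and J is the n×n all-ones matrix, belongs to the k-PSD closure S⁺(n,k): every k×k principal submatrix of G(n,k) is positive semidefinite, and moreover every k×k principal submatrix of G(n,k) is singular (has determinant zero). -/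
open Matrix

theorem principalSub_Gmat_mulVec {n : ℕ} (k : ℕ) (I : Finset (Fin n)) (x : I → ℝ) (i : I) :
    (principalSub (Gmat n k) I *ᵥ x) i =
      (k : ℝ) / ((k : ℝ) - 1) * x i - 1 / ((k : ℝ) - 1) * ∑ j, x j := by
  simp [principalSub, Gmat, mulVec, dotProduct, Matrix.one_apply, sub_mul, Finset.sum_sub_distrib,
    Finset.mul_sum, ite_mul]

theorem principalSub_Gmat_posSemidef {n k : ℕ} (hk : 2 ≤ k) (I : Finset (Fin n))
    (hI : I.card = k) : (principalSub (Gmat n k) I).PosSemidef := by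
  have hk' : (0 : ℝ) ≤ 1 / ((k : ℝ) - 1) := by
    have : (2 : ℝ) ≤ k := by exact_mod_cast hk
    exact one_div_nonneg.mpr (by linarith)
  refine PosSemidef.of_dotProduct_mulVec_nonneg ?_ fun x => ?_
  · rw [IsHermitian, conjTranspose_eq_transpose_of_trivial]
    exact (Gmat_isSymm n k).submatrix _
  · have hcs := sq_sum_le_card_mul_sum_sq (s := Finset.univ) (f := x)
    rw [Finset.card_univ, Fintype.card_coe, hI] at hcs
    have hform : star x ⬝ᵥ (principalSub (Gmat n k) I *ᵥ x) =
        1 / ((k : ℝ) - 1) * ((k : ℝ) * ∑ i, x i ^ 2 - (∑ i, x i) ^ 2) := by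
      simp only [dotProduct, principalSub_Gmat_mulVec, star_trivial, mul_sub,
        Finset.sum_sub_distrib]
      generalize hS : ∑ i, x i = S
      have hsq : S ^ 2 = ∑ i, x i * S := by rw [← Finset.sum_mul, hS, sq]
      rw [hsq, Finset.mul_sum, Finset.mul_sum, Finset.mul_sum]
      congr 1 <;> exact Finset.sum_congr rfl fun i _ => by ring
    rw [hform]
    exact mul_nonneg hk' (sub_nonneg.mpr hcs)

theorem principalSub_Gmat_det {n k : ℕ} (hk : 0 < k) (I : Finset (Fin n)) (hI : I.card = k) :
    (principalSub (Gmat n k) I).det = 0 := by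
  obtain ⟨i, hi⟩ := Finset.card_pos.mp (hI ▸ hk)
  refine exists_mulVec_eq_zero_iff.mp ⟨1, fun h => one_ne_zero (congrFun h ⟨i, hi⟩), ?_⟩
  ext j
  rw [principalSub_Gmat_mulVec]
  simp [hI, div_eq_inv_mul]

/-- For `n ≥ 3` and `2 ≤ k ≤ n-1`, the matrix `G(n,k)` belongs to
`S⁺(n,k)`, and every `k × k` principal submatrix of `G(n,k)` is singular. -/
theorem stmt18 {n k : ℕ} (hn : 3 ≤ n) (hk2 : 2 ≤ k) (hkn : k ≤ n - 1) :
    memPSDClosure k (Gmat n k) ∧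
      ∀ I : Finset (Fin n), I.card = k → (principalSub (Gmat n k) I).det = 0 := by
  exact ⟨⟨Gmat_isSymm n k, principalSub_Gmat_posSemidef hk2⟩,
    principalSub_Gmat_det (by omega)⟩
end
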